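/- Let n ≥ 2 be a natural number, let c ∈ ℂ, and let a, b : Fin n → Fin n → ℂ satisfy (i) ∑_{j=0}^{n-1} a j j = 0 and (ii) b i j = b j i for all i, j. Then ∑_{i=0}^{n-1} ‖(conj c) · (a i 0) + c · conj (b i 0)‖² ≤ ((2n−1)/n) · ‖c‖² · ∑_{i,j} ( ‖a i j‖² + ‖b i j‖² ). -/

import Mathlib

open scoped BigOperators ComplexConjugate

lemma norm_conj_mul_add_mul_conj_sq_le (c z w : ℂ) :
    ‖conj c * z + c * conj w‖ ^ 2 ≤ ‖c‖ ^ 2 * (‖z‖ + ‖w‖) ^ 2 := by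
  have h : ‖conj c * z + c * conj w‖ ≤ ‖c‖ * (‖z‖ + ‖w‖) := by
    simpa [mul_add] using norm_add_le (conj c * z) (c * conj w)
  calc ‖conj c * z + c * conj w‖ ^ 2 ≤ (‖c‖ * (‖z‖ + ‖w‖)) ^ 2 := by gcongr
    _ = ‖c‖ ^ 2 * (‖z‖ + ‖w‖) ^ 2 := mul_pow _ _ _

/-- The Frobenius norm of a trace-free matrix controls its first column, with an improved
constant on the corner entry. -/
lemma sum_norm_sq_ge_of_trace_eq_zero {m : ℕ} (hm : 0 < m)
    (a : Fin (m + 1) → Fin (m + 1) → ℂ) (ha : ∑ j, a j j = 0) :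
    ((m : ℝ) + 1) / m * ‖a 0 0‖ ^ 2 + ∑ i : Fin m, ‖a i.succ 0‖ ^ 2
      ≤ ∑ i, ∑ j, ‖a i j‖ ^ 2 := by
  have hm' : (0 : ℝ) < m := by exact_mod_cast hm
  have hcorner : ‖a 0 0‖ ^ 2 ≤ m * ∑ i : Fin m, ‖a i.succ i.succ‖ ^ 2 := by
    rw [Fin.sum_univ_succ] at ha
    rw [eq_neg_of_add_eq_zero_left ha, norm_neg]
    calc ‖∑ i : Fin m, a i.succ i.succ‖ ^ 2
        ≤ (∑ i : Fin m, ‖a i.succ i.succ‖) ^ 2 := by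
          gcongr
          exact norm_sum_le _ _
      _ ≤ m * ∑ i : Fin m, ‖a i.succ i.succ‖ ^ 2 := by
          simpa using sq_sum_le_card_mul_sum_sq (s := Finset.univ)
            (f := fun i : Fin m => ‖a i.succ i.succ‖)
  have hdiag : ∑ i : Fin m, ‖a i.succ i.succ‖ ^ 2
      ≤ ∑ i : Fin m, ∑ j : Fin m, ‖a i.succ j.succ‖ ^ 2 :=
    Finset.sum_le_sum fun i _ =>
      Finset.single_le_sum (f := fun j : Fin m => ‖a i.succ j.succ‖ ^ 2)
        (fun _ _ => by positivity) (Finset.mem_univ i)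
  have hrow : 0 ≤ ∑ j : Fin m, ‖a 0 j.succ‖ ^ 2 := by positivity
  have hdiv : ‖a 0 0‖ ^ 2 / m ≤ ∑ i : Fin m, ‖a i.succ i.succ‖ ^ 2 := by
    rwa [div_le_iff₀' hm']
  have hsplit : ((m : ℝ) + 1) / m * ‖a 0 0‖ ^ 2 = ‖a 0 0‖ ^ 2 + ‖a 0 0‖ ^ 2 / m := by
    field_simp
  simp only [Fin.sum_univ_succ (n := m), Finset.sum_add_distrib]
  linarith

/-- The Frobenius norm of a symmetric matrix counts the off-diagonal part of its first column
twice. -/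
lemma sum_norm_sq_ge_of_symm {m : ℕ} (b : Fin (m + 1) → Fin (m + 1) → ℂ)
    (hb : ∀ i j, b i j = b j i) :
    ‖b 0 0‖ ^ 2 + 2 * ∑ i : Fin m, ‖b i.succ 0‖ ^ 2 ≤ ∑ i, ∑ j, ‖b i j‖ ^ 2 := by
  have hrest : 0 ≤ ∑ i : Fin m, ∑ j : Fin m, ‖b i.succ j.succ‖ ^ 2 := by positivity
  have hrow : ∑ j : Fin m, ‖b 0 j.succ‖ ^ 2 = ∑ j : Fin m, ‖b j.succ 0‖ ^ 2 :=
    Finset.sum_congr rfl fun j _ => by rw [hb]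
  simp only [Fin.sum_univ_succ (n := m), Finset.sum_add_distrib]
  linarith

lemma add_sq_le_corner {m : ℝ} (hm : 0 < m) (x y : ℝ) :
    (x + y) ^ 2 ≤ (2 * m + 1) / (m + 1) * ((m + 1) / m * x ^ 2 + y ^ 2) := by
  have h : (2 * m + 1) / (m + 1) * ((m + 1) / m * x ^ 2 + y ^ 2) - (x + y) ^ 2
      = ((m + 1) * x - m * y) ^ 2 / (m * (m + 1)) := by
    field_simp
    ring
  have : 0 ≤ ((m + 1) * x - m * y) ^ 2 / (m * (m + 1)) := by positivity
  linarith

lemma add_sq_le_off_corner {m : ℝ} (hm : 1 ≤ m) (x y : ℝ) :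
    (x + y) ^ 2 ≤ (2 * m + 1) / (m + 1) * (x ^ 2 + 2 * y ^ 2) := by
  have h : 3 / 2 ≤ (2 * m + 1) / (m + 1) := by
    rw [div_le_div_iff₀ (by norm_num) (by linarith)]
    linarith
  calc (x + y) ^ 2 ≤ 3 / 2 * (x ^ 2 + 2 * y ^ 2) := by nlinarith [sq_nonneg (x - 2 * y)]
    _ ≤ _ := by gcongr

/-- The pointwise linear-algebraic content of the improved Kato inequality
`|∇|η||² ≤ (1 − 1/(2n)) |∇η|²` for a `∂̄`-closed and `∂̄`-coclosed line-bundle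
valued `(0,1)`-form: `a i j` represents `∇_i η_{j̄}` (trace-free by `∂̄*η = 0`)
and `b i j` represents `∇_{ī} η_{j̄}` (symmetric by `∂̄η = 0`). -/
theorem improved_kato_pointwise (n : ℕ) (hn : 2 ≤ n) (c : ℂ)
    (a b : Fin n → Fin n → ℂ)
    (ha : ∑ j, a j j = 0) (hb : ∀ i j, b i j = b j i) :
    ∑ i, ‖(conj c) * a i ⟨0, by omega⟩ + c * conj (b i ⟨0, by omega⟩)‖ ^ 2
      ≤ (2 * (n : ℝ) - 1) / n * ‖c‖ ^ 2 * ∑ i, ∑ j, (‖a i j‖ ^ 2 + ‖b i j‖ ^ 2) := by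
  obtain ⟨m, rfl⟩ : ∃ m, n = m + 1 := ⟨n - 1, by omega⟩
  have hm : (1 : ℝ) ≤ m := by exact_mod_cast (by omega : 1 ≤ m)
  have hA := sum_norm_sq_ge_of_trace_eq_zero (by omega) a ha
  have hB := sum_norm_sq_ge_of_symm b hb
  have hK : (2 * ((m + 1 : ℕ) : ℝ) - 1) / ((m + 1 : ℕ) : ℝ) = (2 * m + 1) / (m + 1) := by
    push_cast
    ring
  rw [hK]
  change ∑ i, ‖conj c * a i 0 + c * conj (b i 0)‖ ^ 2 ≤ _
  set K : ℝ := (2 * m + 1) / (m + 1)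
  have hK0 : 0 ≤ K := by positivity
  calc ∑ i, ‖conj c * a i 0 + c * conj (b i 0)‖ ^ 2
      ≤ ∑ i, ‖c‖ ^ 2 * (‖a i 0‖ + ‖b i 0‖) ^ 2 :=
        Finset.sum_le_sum fun i _ => norm_conj_mul_add_mul_conj_sq_le c _ _
    _ = ‖c‖ ^ 2 * ((‖a 0 0‖ + ‖b 0 0‖) ^ 2
          + ∑ i : Fin m, (‖a i.succ 0‖ + ‖b i.succ 0‖) ^ 2) := by
        rw [← Finset.mul_sum, Fin.sum_univ_succ]
    _ ≤ ‖c‖ ^ 2 * (K * ((m + 1) / m * ‖a 0 0‖ ^ 2 + ‖b 0 0‖ ^ 2)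
          + ∑ i : Fin m, K * (‖a i.succ 0‖ ^ 2 + 2 * ‖b i.succ 0‖ ^ 2)) := by
        gcongr
        · exact add_sq_le_corner (by linarith) _ _
        · exact add_sq_le_off_corner hm _ _
    _ = K * ‖c‖ ^ 2 * (((m + 1) / m * ‖a 0 0‖ ^ 2 + ∑ i : Fin m, ‖a i.succ 0‖ ^ 2)
          + (‖b 0 0‖ ^ 2 + 2 * ∑ i : Fin m, ‖b i.succ 0‖ ^ 2)) := by
        rw [← Finset.mul_sum, Finset.sum_add_distrib, ← Finset.mul_sum]
        ring
    _ ≤ K * ‖c‖ ^ 2 * (∑ i, ∑ j, ‖a i j‖ ^ 2 + ∑ i, ∑ j, ‖b i j‖ ^ 2) := by gcongr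
    _ = K * ‖c‖ ^ 2 * ∑ i, ∑ j, (‖a i j‖ ^ 2 + ‖b i j‖ ^ 2) := by
        simp only [Finset.sum_add_distrib]
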